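/- Let N be a weight sequence in the class 𝓛𝓒 which is nonquasianalytic, and let p ≥ 2 be an integer with (ν_p/p)·∑_{k≥p} 1/ν_k ≤ 1. Then the minimum defining L_p is attained at j = p−1, i.e. L_p = (p/∑_{k≥p} 1/ν_k)·N_{p−1}, and moreover (L_p/p^p)^{1/p} ≥ (N_p)^{1/p}/p. -/

import Mathlib

open Filter

noncomputable def nuq (N : ℕ → ℝ) (p : ℕ) : ℝ := N p / N (p - 1)

def IsLC (N : ℕ → ℝ) : Prop :=
  (∀ p, 0 < N p) ∧ N 0 = 1 ∧ N 0 ≤ N 1 ∧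
    (∀ p, 1 ≤ p → (N p) ^ 2 ≤ N (p - 1) * N (p + 1)) ∧
    Tendsto (fun p : ℕ => (N p) ^ ((1 : ℝ) / p)) atTop atTop

def NQA (N : ℕ → ℝ) : Prop := Summable (fun p : ℕ => 1 / nuq N (p + 1))

noncomputable def tailSum (N : ℕ → ℝ) (p : ℕ) : ℝ := ∑' k : ℕ, 1 / nuq N (p + k)

noncomputable def lamSV (M N : ℕ → ℝ) (s p : ℕ) : ℝ :=
  ⨆ j : Fin p, (M p / ((s : ℝ) ^ p * N j)) ^ ((1 : ℝ) / ((p : ℝ) - (j : ℕ)))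

def SVcond (M N : ℕ → ℝ) : Prop :=
  ∃ s : ℕ, 1 ≤ s ∧ ∃ B : ℝ, ∀ p : ℕ, 1 ≤ p → lamSV M N s p / p * tailSum N p ≤ B

noncomputable def Lseq (N : ℕ → ℝ) (s p : ℕ) : ℝ :=
  if p = 0 then 1
  else (s : ℝ) ^ p * ⨅ j : Fin p, ((p : ℝ) / tailSum N p) ^ (p - (j : ℕ)) * N j

noncomputable def LseqC (N : ℕ → ℝ) (s : ℕ) (C : ℝ) (p : ℕ) : ℝ :=
  if p = 0 then 1
  else (s : ℝ) ^ p * ⨅ j : Fin p, (C * p / tailSum N p) ^ (p - (j : ℕ)) * N j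

def Preceq (M N : ℕ → ℝ) : Prop :=
  ∃ B : ℝ, ∀ p : ℕ, 1 ≤ p → (M p / N p) ^ ((1 : ℝ) / p) ≤ B

def SeqEquiv (M N : ℕ → ℝ) : Prop := Preceq M N ∧ Preceq N M

def Gamma1 (N : ℕ → ℝ) : Prop :=
  ∃ B : ℝ, ∀ p : ℕ, 1 ≤ p → nuq N p / p * tailSum N p ≤ B

def MG (N : ℕ → ℝ) : Prop :=
  ∃ C : ℝ, 1 ≤ C ∧ ∀ j k : ℕ, N (j + k) ≤ C ^ (j + k) * N j * N k

noncomputable def tauD (N : ℕ → ℝ) (p : ℕ) : ℝ := p / nuq N p + tailSum N p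

noncomputable def sigmaD (N : ℕ → ℝ) (p : ℕ) : ℝ :=
  if p = 0 then 1 else tauD N 1 * p / tauD N p

noncomputable def Sdesc (N : ℕ → ℝ) (p : ℕ) : ℝ :=
  ∏ i ∈ Finset.range (p + 1), sigmaD N i

def AlmostIncreasing (a : ℕ → ℝ) : Prop :=
  ∃ C : ℝ, 1 ≤ C ∧ ∀ p q : ℕ, 1 ≤ p → p ≤ q → a p ≤ C * a q

noncomputable def BorelMap (f : ℝ → ℂ) : ℕ → ℂ := fun p => iteratedDeriv p f 0

def DRoumieu (N : ℕ → ℝ) : Set (ℝ → ℂ) :=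
  {f | ContDiff ℝ (⊤ : ℕ∞) f ∧ Function.support f ⊆ Set.Icc (-1 : ℝ) 1 ∧
    ∃ C h : ℝ, 0 < C ∧ 0 < h ∧ ∀ p x, ‖iteratedDeriv p f x‖ ≤ C * h ^ p * N p}

def LambdaRoumieu (M : ℕ → ℝ) : Set (ℕ → ℂ) :=
  {a | ∃ C h : ℝ, 0 < C ∧ 0 < h ∧ ∀ p, ‖a p‖ ≤ C * h ^ p * M p}

def DBeurling (N : ℕ → ℝ) : Set (ℝ → ℂ) :=
  {f | ContDiff ℝ (⊤ : ℕ∞) f ∧ Function.support f ⊆ Set.Icc (-1 : ℝ) 1 ∧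
    ∀ h : ℝ, 0 < h → ∃ C : ℝ, 0 < C ∧ ∀ p x, ‖iteratedDeriv p f x‖ ≤ C * h ^ p * N p}

def LambdaBeurling (M : ℕ → ℝ) : Set (ℕ → ℂ) :=
  {a | ∀ h : ℝ, 0 < h → ∃ C : ℝ, 0 < C ∧ ∀ p, ‖a p‖ ≤ C * h ^ p * M p}

theorem IsLC.nuq_pos {N : ℕ → ℝ} (hN : IsLC N) (k : ℕ) : 0 < nuq N k :=
  div_pos (hN.1 _) (hN.1 _)

theorem IsLC.monotone_nuq_succ {N : ℕ → ℝ} (hN : IsLC N) :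
    Monotone fun k => nuq N (k + 1) := by
  refine monotone_nat_of_le_succ fun k => ?_
  have h := hN.2.2.2.1 (k + 1) (by omega)
  simp only [nuq, Nat.add_sub_cancel] at h ⊢
  rw [div_le_div_iff₀ (hN.1 _) (hN.1 _)]
  nlinarith

theorem IsLC.tailSum_pos {N : ℕ → ℝ} (hN : IsLC N) (hnq : NQA N) {p : ℕ} (hp : 1 ≤ p) :
    0 < tailSum N p := by
  have hs : Summable fun k : ℕ => 1 / nuq N (p + k) := by
    refine ((summable_nat_add_iff (p - 1)).2 hnq).congr fun k => ?_
    rw [show k + (p - 1) + 1 = p + k by omega]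
  exact hs.tsum_pos (fun k => (one_div_pos.2 (hN.nuq_pos _)).le) 0
    (one_div_pos.2 (hN.nuq_pos _))

/-- If all quotients up to index `j + m` are at most `A`, then `N` grows by at most the factor `A`
at each step from `j` to `j + m`. -/
theorem IsLC.apply_add_le_pow_mul {N : ℕ → ℝ} (hN : IsLC N) {A : ℝ} (j m : ℕ)
    (hA : ∀ i < j + m, nuq N (i + 1) ≤ A) : N (j + m) ≤ A ^ m * N j := by
  induction m with
  | zero => simp
  | succ m ih =>
    have hstep := hA (j + m) (by omega)
    have hA0 : 0 ≤ A := (hN.nuq_pos _).le.trans hstep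
    rw [nuq, Nat.add_sub_cancel, div_le_iff₀ (hN.1 _)] at hstep
    calc N (j + (m + 1)) ≤ A * N (j + m) := hstep
      _ ≤ A * (A ^ m * N j) :=
        mul_le_mul_of_nonneg_left (ih fun i hi => hA i (by omega)) hA0
      _ = A ^ (m + 1) * N j := by ring

theorem stmt12 (N : ℕ → ℝ) (hN : IsLC N) (hnq : NQA N)
    (p : ℕ) (hp : 2 ≤ p) (hcond : nuq N p / p * tailSum N p ≤ 1) :
    Lseq N 1 p = ((p : ℝ) / tailSum N p) * N (p - 1) ∧
      (N p) ^ ((1 : ℝ) / p) / p ≤ (Lseq N 1 p / (p : ℝ) ^ p) ^ ((1 : ℝ) / p) := by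
  obtain ⟨q, rfl⟩ : ∃ q, p = q + 1 := ⟨p - 1, by omega⟩
  have hT := hN.tailSum_pos hnq (p := q + 1) (by omega)
  have hq : (0 : ℝ) < ((q + 1 : ℕ) : ℝ) := by positivity
  have hA : nuq N (q + 1) ≤ ((q + 1 : ℕ) : ℝ) / tailSum N (q + 1) := by
    rw [le_div_iff₀ hT]
    rwa [div_mul_eq_mul_div, div_le_one hq] at hcond
  have hL : Lseq N 1 (q + 1)
      = (((q + 1 : ℕ) : ℝ) / tailSum N (q + 1)) * N (q + 1 - 1) := by
    rw [Lseq, if_neg (by omega), Nat.cast_one, one_pow, one_mul, Nat.add_sub_cancel]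
    set A : ℝ := ((q + 1 : ℕ) : ℝ) / tailSum N (q + 1)
    have hA0 : 0 ≤ A := (hN.nuq_pos _).le.trans hA
    apply le_antisymm
    · refine (ciInf_le (Set.finite_range _).bddBelow (Fin.last q)).trans_eq ?_
      simp
    · refine le_ciInf fun j => ?_
      obtain ⟨m, hm⟩ : ∃ m, q = j + m := ⟨q - j, by omega⟩
      have h := hN.apply_add_le_pow_mul (A := A) j m
        fun i hi => (hN.monotone_nuq_succ (by omega : i ≤ q)).trans hA
      rw [← hm] at h
      rw [show q + 1 - (j : ℕ) = m + 1 by omega, pow_succ', mul_assoc]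
      exact mul_le_mul_of_nonneg_left h hA0
  refine ⟨hL, ?_⟩
  have hNL : N (q + 1) ≤ Lseq N 1 (q + 1) := by
    rw [hL]
    rwa [nuq, div_le_iff₀ (hN.1 _)] at hA
  have hroot : (((q + 1 : ℕ) : ℝ) ^ (q + 1)) ^ ((1 : ℝ) / (q + 1 : ℕ)) = ((q + 1 : ℕ) : ℝ) := by
    rw [one_div, Real.pow_rpow_inv_natCast hq.le (by omega)]
  rw [Real.div_rpow ((hN.1 _).le.trans hNL) (by positivity), hroot]
  exact div_le_div_of_nonneg_right
    (Real.rpow_le_rpow (hN.1 _).le hNL (by positivity)) hq.le
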